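/- Let φ be a smooth positive function on 𝕊ⁿ and fix x ∈ 𝕊ⁿ. Choose a local orthonormal frame such that the Hessian (φ_{ij}) is diagonal at x. Then at x, the covariant derivatives of A = A[φ] satisfy A_{αβi} − A_{iβα} = (φ_α/φ) A_{αα} δ_{iβ} − (φ_i/φ) A_{ii} δ_{αβ} for all indices i, α, β ∈ {1,…,n}. -/

import Mathlib

open scoped RealInnerProductSpace
open Finset

noncomputable section

/-- Euclidean space `ℝ^(n+1)`, the ambient space of the unit sphere `𝕊ⁿ`. -/
abbrev Euc (n : ℕ) : Type := EuclideanSpace ℝ (Fin (n + 1))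

/-- The unit sphere `𝕊ⁿ ⊆ ℝ^(n+1)`. -/
def uSphere (n : ℕ) : Set (Euc n) := Metric.sphere (0 : Euc n) 1

/-- Orthogonal projection onto the tangent space of the sphere at (the normalization of) `x`. -/
def tanProj {n : ℕ} (x v : Euc n) : Euc n := v - (⟪x, v⟫ / ‖x‖ ^ 2) • x

/-- `f` is (the 0-homogeneous extension of) a function on the sphere. -/
def Homog0 {n : ℕ} (f : Euc n → ℝ) : Prop := ∀ (c : ℝ) (y : Euc n), 0 < c → f (c • y) = f y

/-- Smoothness of a function on the sphere, expressed via its 0-homogeneous extension. -/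
def SmoothFn {n : ℕ} (f : Euc n → ℝ) : Prop := ContDiffOn ℝ (⊤ : ℕ∞) f {y : Euc n | y ≠ 0}

/-- `f(x) = f(-x)` for all `x`. -/
def EvenFn {n : ℕ} (f : Euc n → ℝ) : Prop := ∀ y, f (-y) = f y

/-- Covariant (tangential) derivative of a function on the sphere, in direction `v`. -/
def covD {n : ℕ} (f : Euc n → ℝ) (x v : Euc n) : ℝ := fderiv ℝ f x (tanProj x v)

/-- Spherical (tangential) gradient. -/
def gradS {n : ℕ} (f : Euc n → ℝ) (x : Euc n) : Euc n := tanProj x (gradient f x)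

/-- Covariant Hessian `(D²f)(v,w)` of a function on the round sphere. -/
def hessS {n : ℕ} (f : Euc n → ℝ) (x v w : Euc n) : ℝ :=
  fderiv ℝ (fun y => covD f y w) x (tanProj x v)

/-- The symmetric 2-tensor
`A[φ](v,w) = (D²φ)(v,w) - (|Dφ|²/(2φ)) σ(v,w) + ((φ - 1/φ)/2) σ(v,w)` on the sphere. -/
def Aform {n : ℕ} (φ : Euc n → ℝ) (x v w : Euc n) : ℝ :=
  hessS φ x v w +
    ((φ x - (φ x)⁻¹) / 2 - ‖gradS φ x‖ ^ 2 / (2 * φ x)) * ⟪tanProj x v, tanProj x w⟫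

/-- `φ` is h-convex: `A[φ] ≥ 0` on the sphere. -/
def HConvex {n : ℕ} (φ : Euc n → ℝ) : Prop :=
  ∀ x ∈ uSphere n, ∀ v : Euc n, ⟪x, v⟫ = 0 → 0 ≤ Aform φ x v v

/-- `φ` is uniformly h-convex: `A[φ] > 0` on the sphere. -/
def UnifHConvex {n : ℕ} (φ : Euc n → ℝ) : Prop :=
  ∀ x ∈ uSphere n, ∀ v : Euc n, ⟪x, v⟫ = 0 → v ≠ 0 → 0 < Aform φ x v v

/-- `σ_k` of a square matrix: the sum of its principal `k × k` minors
(equivalently, the `k`-th elementary symmetric function of its eigenvalues). -/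
def sigmaMat {N : ℕ} (k : ℕ) (M : Matrix (Fin N) (Fin N) ℝ) : ℝ :=
  ∑ s ∈ Finset.powersetCard k (Finset.univ : Finset (Fin N)),
    Matrix.det (Matrix.of fun i j : {a : Fin N // a ∈ s} => M i.1 j.1)

/-- `e` is an orthonormal frame of the tangent space of `𝕊ⁿ` at `x`. -/
def OrthoFrame {n : ℕ} (x : Euc n) (e : Fin n → Euc n) : Prop :=
  (∀ i, ⟪x, e i⟫ = 0) ∧ ∀ i j, ⟪e i, e j⟫ = if i = j then 1 else 0

/-- The matrix of `A[φ]` at `x` with respect to an orthonormal tangent frame `e`. -/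
def Amat {n : ℕ} (φ : Euc n → ℝ) (x : Euc n) (e : Fin n → Euc n) : Matrix (Fin n) (Fin n) ℝ :=
  Matrix.of fun i j => Aform φ x (e i) (e j)

/-- `φ` solves the horospherical `p`-Christoffel-Minkowski equation
`σ_k(A[φ]) = φ^(p-k) f` on `𝕊ⁿ`. -/
def SolvesCM (n k : ℕ) (p : ℝ) (f φ : Euc n → ℝ) : Prop :=
  ∀ x ∈ uSphere n, ∀ e : Fin n → Euc n, OrthoFrame x e →
    sigmaMat k (Amat φ x e) = φ x ^ (p - (k : ℝ)) * f x

/-- Supremum (maximum) of a function over the sphere. -/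
def sphSup {n : ℕ} (f : Euc n → ℝ) : ℝ := sSup (f '' uSphere n)

/-- Infimum (minimum) of a function over the sphere. -/
def sphInf {n : ℕ} (f : Euc n → ℝ) : ℝ := sInf (f '' uSphere n)

/-- The function `f^(-1/q)`. -/
def negPowExt {n : ℕ} (f : Euc n → ℝ) (q : ℝ) : Euc n → ℝ := fun y => f y ^ (-(1 / q))

/-- Assumption 1.3 of the paper (Assumption (A)): the gradient-and-Hessian conditions on the
prescribed function `f`, according to the value of `p`. -/
def AssumptionA (n k : ℕ) (p : ℝ) (f : Euc n → ℝ) : Prop :=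
  ((p = 0) →
    ∀ x ∈ uSphere n, ∀ v : Euc n, ⟪x, v⟫ = 0 →
      0 ≤ hessS (negPowExt f (k : ℝ)) x v v - ‖gradS (negPowExt f (k : ℝ)) x‖ * ‖v‖ ^ 2 +
          negPowExt f (k : ℝ) x /
              (2 + 8 * sphSup fun y => (f y / (n.choose k : ℝ)) ^ (1 / (k : ℝ))) * ‖v‖ ^ 2) ∧
  ((0 < p ∧ p ≤ (k : ℝ) / 2) →
    ∀ x ∈ uSphere n, ∀ v : Euc n, ⟪x, v⟫ = 0 →
      0 ≤ hessS (negPowExt f (k : ℝ)) x v v -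
            (((k : ℝ) + 2 * p) / (k : ℝ)) * ‖gradS (negPowExt f (k : ℝ)) x‖ * ‖v‖ ^ 2 +
          (p ^ 2 / (k : ℝ) ^ 2) * negPowExt f (k : ℝ) x * ‖v‖ ^ 2) ∧
  (((k : ℝ) / 2 < p ∧ p < (k : ℝ)) →
    ∀ x ∈ uSphere n, ∀ v : Euc n, ⟪x, v⟫ = 0 →
      0 ≤ hessS (negPowExt f (k : ℝ)) x v v -
            ((3 * (k : ℝ) - 2 * p) ^ 2 / (p * (2 * p - (k : ℝ)))) *
              (‖gradS (negPowExt f (k : ℝ)) x‖ ^ 2 / (2 * negPowExt f (k : ℝ) x)) * ‖v‖ ^ 2 +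
          (p / (2 * (k : ℝ))) * negPowExt f (k : ℝ) x * ‖v‖ ^ 2) ∧
  (((k : ℝ) ≤ p ∧ p < 2 * (k : ℝ)) →
    ∀ x ∈ uSphere n, ∀ v : Euc n, ⟪x, v⟫ = 0 →
      0 ≤ hessS (negPowExt f p) x v v -
            (‖gradS (negPowExt f p) x‖ ^ 2 / (2 * negPowExt f p x)) * ‖v‖ ^ 2 +
          (1 / 2) * negPowExt f p x * ‖v‖ ^ 2) ∧
  ((p = 2 * (k : ℝ)) →
    sphSup f < (n.choose k : ℝ) / 2 ^ k ∧
    ∀ x ∈ uSphere n, ∀ v : Euc n, ⟪x, v⟫ = 0 →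
      0 ≤ hessS (negPowExt f p) x v v -
            (‖gradS (negPowExt f p) x‖ ^ 2 / (2 * negPowExt f p x)) * ‖v‖ ^ 2 +
          (1 / 2) * negPowExt f p x * ‖v‖ ^ 2) ∧
  ((2 * (k : ℝ) < p) →
    2 ≤ k ∧
    sphInf f ≤
      (k : ℝ) ^ k * (p - 2 * (k : ℝ)) ^ ((p - 2 * (k : ℝ)) / 2) / p ^ (p / 2) * (n.choose k : ℝ) ∧
    ∀ x ∈ uSphere n, ∀ v : Euc n, ⟪x, v⟫ = 0 →
      0 ≤ hessS (negPowExt f p) x v v -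
            (‖gradS (negPowExt f p) x‖ ^ 2 / (2 * negPowExt f p x)) * ‖v‖ ^ 2 +
          ((k : ℝ) / p) * negPowExt f p x * ‖v‖ ^ 2)

/-- First covariant derivative of the 2-tensor `A[φ]` on the round sphere:
`covA1 φ x v w z = (∇_v A)(w, z) = A_{wz;v}`.  (Tangent vectors are extended around the
sphere by 0-homogeneous projection, which is parallel at the base point.) -/
def covA1 {n : ℕ} (φ : Euc n → ℝ) (x v w z : Euc n) : ℝ :=
  fderiv ℝ (fun y => Aform φ y (tanProj y w) (tanProj y z)) x (tanProj x v)

lemma inner_tanProj {n : ℕ} (y v : Euc n) : ⟪y, tanProj y v⟫ = 0 := by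
  rcases eq_or_ne y 0 with rfl | hy
  · simp
  · have : ‖y‖ ^ 2 ≠ 0 := by positivity
    rw [tanProj, inner_sub_right, inner_smul_right, real_inner_self_eq_norm_sq]
    field_simp
    ring

lemma tanProj_eq_self {n : ℕ} {y v : Euc n} (h : ⟪y, v⟫ = 0) : tanProj y v = v := by
  simp [tanProj, h]

lemma tanProj_tanProj {n : ℕ} (y v : Euc n) : tanProj y (tanProj y v) = tanProj y v :=
  tanProj_eq_self (inner_tanProj y v)

lemma SmoothFn.contDiffAt {n : ℕ} {f : Euc n → ℝ} (hf : SmoothFn f) {y : Euc n} (hy : y ≠ 0) :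
    ContDiffAt ℝ (⊤ : ℕ∞) f y :=
  ContDiffOn.contDiffAt hf (isOpen_ne.mem_nhds hy)

lemma SmoothFn.contDiffAt_fderiv {n : ℕ} {f : Euc n → ℝ} (hf : SmoothFn f) {y : Euc n}
    (hy : y ≠ 0) : ContDiffAt ℝ (⊤ : ℕ∞) (fderiv ℝ f) y :=
  (hf.contDiffAt hy).fderiv_right (by simp)

lemma SmoothFn.contDiffAt_fderiv_fderiv {n : ℕ} {f : Euc n → ℝ} (hf : SmoothFn f) {y : Euc n}
    (hy : y ≠ 0) : ContDiffAt ℝ (⊤ : ℕ∞) (fderiv ℝ (fderiv ℝ f)) y :=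
  (hf.contDiffAt_fderiv hy).fderiv_right (by simp)

lemma SmoothFn.fderiv_fderiv_comm {n : ℕ} {f : Euc n → ℝ} (hf : SmoothFn f) {y : Euc n}
    (hy : y ≠ 0) (v w : Euc n) :
    fderiv ℝ (fderiv ℝ f) y v w = fderiv ℝ (fderiv ℝ f) y w v :=
  (hf.contDiffAt hy).isSymmSndFDerivAt
    (by simpa using WithTop.coe_le_coe.2 (le_top (a := (2 : ℕ∞)))) v w

lemma SmoothFn.fderiv_fderiv_fderiv_comm {n : ℕ} {f : Euc n → ℝ} (hf : SmoothFn f) {y : Euc n}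
    (hy : y ≠ 0) (v w : Euc n) :
    fderiv ℝ (fderiv ℝ (fderiv ℝ f)) y v w = fderiv ℝ (fderiv ℝ (fderiv ℝ f)) y w v :=
  (hf.contDiffAt_fderiv hy).isSymmSndFDerivAt
    (by simpa using WithTop.coe_le_coe.2 (le_top (a := (2 : ℕ∞)))) v w

/-- Euler's identity for a function that is homogeneous of degree `0`. -/
lemma Homog0.fderiv_self {n : ℕ} {f : Euc n → ℝ} (h0 : Homog0 f) (hf : SmoothFn f) {y : Euc n}
    (hy : y ≠ 0) : fderiv ℝ f y y = 0 := by
  have hd := ((hf.contDiffAt hy).differentiableAt (by simp)).hasFDerivAt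
  have h1 : HasDerivAt (fun t : ℝ => f (y + t • y)) (fderiv ℝ f y y) 0 := hd.hasLineDerivAt y
  have h2 : (fun t : ℝ => f (y + t • y)) =ᶠ[nhds 0] fun _ => f y := by
    filter_upwards [lt_mem_nhds (show (-1 : ℝ) < 0 by norm_num)] with t ht
    rw [← h0 (1 + t) y (by linarith), add_smul, one_smul]
  exact h1.unique ((hasDerivAt_const (0 : ℝ) (f y)).congr_of_eventuallyEq h2)

/-- Euler's identity for the differential, which is homogeneous of degree `-1`. -/
lemma Homog0.fderiv_fderiv_self {n : ℕ} {f : Euc n → ℝ} (h0 : Homog0 f) (hf : SmoothFn f)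
    {y : Euc n} (hy : y ≠ 0) (v : Euc n) :
    fderiv ℝ (fderiv ℝ f) y v y = -fderiv ℝ f y v := by
  have hd := ((hf.contDiffAt_fderiv hy).differentiableAt (by simp)).hasFDerivAt
  have h1 := hd.clm_apply (hasFDerivAt_id y)
  have h2 : (fun z => fderiv ℝ f z (id z)) =ᶠ[nhds y] fun _ => 0 := by
    filter_upwards [isOpen_ne.mem_nhds hy] with z hz
    exact h0.fderiv_self hf hz
  have h3 := h1.unique ((hasFDerivAt_const (0 : ℝ) y).congr_of_eventuallyEq h2)
  have h4 := DFunLike.congr_fun h3 v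
  simp at h4
  linarith

lemma Homog0.covD_eq {n : ℕ} {f : Euc n → ℝ} (h0 : Homog0 f) (hf : SmoothFn f) {y : Euc n}
    (hy : y ≠ 0) (w : Euc n) : covD f y w = fderiv ℝ f y w := by
  simp [covD, tanProj, h0.fderiv_self hf hy]

lemma Homog0.hessS_eq {n : ℕ} {f : Euc n → ℝ} (h0 : Homog0 f) (hf : SmoothFn f) {y : Euc n}
    (hy : y ≠ 0) (v w : Euc n) :
    hessS f y v w = fderiv ℝ (fderiv ℝ f) y (tanProj y v) w := by
  have hd := ((hf.contDiffAt_fderiv hy).differentiableAt (by simp)).hasFDerivAt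
  have h1 := hd.clm_apply (hasFDerivAt_const w y)
  have h2 : (fun z => covD f z w) =ᶠ[nhds y] fun z => fderiv ℝ f z w := by
    filter_upwards [isOpen_ne.mem_nhds hy] with z hz
    exact h0.covD_eq hf hz w
  rw [hessS, h2.fderiv_eq, h1.fderiv]
  simp

lemma Homog0.gradS_eq {n : ℕ} {f : Euc n → ℝ} (h0 : Homog0 f) (hf : SmoothFn f) {y : Euc n}
    (hy : y ≠ 0) : gradS f y = gradient f y := by
  apply tanProj_eq_self
  rw [real_inner_comm, gradient, InnerProductSpace.toDual_symm_apply, h0.fderiv_self hf hy]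

/-- The coefficient of the round metric in `A[φ]`. -/
def metricCoeff {n : ℕ} (φ : Euc n → ℝ) (y : Euc n) : ℝ :=
  (φ y - (φ y)⁻¹) / 2 - ‖gradS φ y‖ ^ 2 / (2 * φ y)

lemma Homog0.Aform_tanProj {n : ℕ} {φ : Euc n → ℝ} (h0 : Homog0 φ) (hφ : SmoothFn φ) {y : Euc n}
    (hy : y ≠ 0) (w z : Euc n) :
    Aform φ y (tanProj y w) (tanProj y z) =
      fderiv ℝ (fderiv ℝ φ) y (tanProj y w) (tanProj y z) +
        metricCoeff φ y * ⟪tanProj y w, tanProj y z⟫ := by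
  rw [Aform, h0.hessS_eq hφ hy, tanProj_tanProj, tanProj_tanProj, metricCoeff]

lemma exists_hasFDerivAt_tanProj {n : ℕ} {x w : Euc n} (hx : ‖x‖ = 1) (hw : ⟪x, w⟫ = 0) :
    ∃ L : Euc n →L[ℝ] Euc n, HasFDerivAt (fun y => tanProj y w) L x ∧
      ∀ v, L v = -(⟪v, w⟫ • x) := by
  have hx0 : x ≠ 0 := by rintro rfl; simp at hx
  have hn : ‖x‖ ^ 2 ≠ 0 := by positivity
  have hd : DifferentiableAt ℝ (fun y : Euc n => (‖y‖ ^ 2)⁻¹) x :=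
    ((differentiableAt_id.norm_sq ℝ).inv hn)
  have hs := ((hasFDerivAt_id (𝕜 := ℝ) x).inner ℝ (hasFDerivAt_const w x)).mul hd.hasFDerivAt
  have h := (hasFDerivAt_const w x).sub (hs.smul (hasFDerivAt_id (𝕜 := ℝ) x))
  refine ⟨_, h, fun v => ?_⟩
  simp [hw, hx]

/-- The covariant derivative of `A[φ]` in terms of the Euclidean derivatives of `φ`. -/
lemma Homog0.covA1_eq {n : ℕ} {φ : Euc n → ℝ} (h0 : Homog0 φ) (hφ : SmoothFn φ) {x : Euc n}
    (hx : ‖x‖ = 1) (hc : DifferentiableAt ℝ (metricCoeff φ) x) {v w z : Euc n}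
    (hv : ⟪x, v⟫ = 0) (hw : ⟪x, w⟫ = 0) (hz : ⟪x, z⟫ = 0) :
    covA1 φ x v w z =
      fderiv ℝ (fderiv ℝ (fderiv ℝ φ)) x v w z + ⟪v, w⟫ * fderiv ℝ φ x z +
        ⟪v, z⟫ * fderiv ℝ φ x w + fderiv ℝ (metricCoeff φ) x v * ⟪w, z⟫ := by
  have hx0 : x ≠ 0 := by rintro rfl; simp at hx
  obtain ⟨L, hL, hLv⟩ := exists_hasFDerivAt_tanProj hx hw
  obtain ⟨M, hM, hMv⟩ := exists_hasFDerivAt_tanProj hx hz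
  have hd := ((hφ.contDiffAt_fderiv_fderiv hx0).differentiableAt (by simp)).hasFDerivAt
  have h := ((hd.clm_apply hL).clm_apply hM).add (hc.hasFDerivAt.mul (hL.inner ℝ hM))
  have he : (fun y => Aform φ y (tanProj y w) (tanProj y z)) =ᶠ[nhds x]
      ((fun y => fderiv ℝ (fderiv ℝ φ) y (tanProj y w) (tanProj y z)) +
        metricCoeff φ * fun y => ⟪tanProj y w, tanProj y z⟫) := by
    filter_upwards [isOpen_ne.mem_nhds hx0] with y hy
    exact h0.Aform_tanProj hφ hy w z
  rw [covA1, tanProj_eq_self hv, (h.congr_of_eventuallyEq he).fderiv]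
  have hxz : ⟪z, x⟫ = 0 := by rw [real_inner_comm, hz]
  have hxw : ⟪w, x⟫ = 0 := by rw [real_inner_comm, hw]
  simp [hLv, hMv, tanProj_eq_self hw, tanProj_eq_self hz, hz, hxw,
    h0.fderiv_fderiv_self hφ hx0, hφ.fderiv_fderiv_comm hx0 x z, inner_smul_left,
    inner_smul_right]
  ring

/-- The orthonormal basis of the ambient space formed by a point of the sphere and an
orthonormal frame of its tangent space. -/
lemma OrthoFrame.exists_orthonormalBasis {n : ℕ} {x : Euc n} {e : Fin n → Euc n}
    (he : OrthoFrame x e) (hx : ‖x‖ = 1) :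
    ∃ b : OrthonormalBasis (Fin (n + 1)) ℝ (Euc n), b 0 = x ∧ ∀ i, b (Fin.succ i) = e i := by
  have hon : Orthonormal ℝ (Fin.cons x e : Fin (n + 1) → Euc n) := by
    rw [orthonormal_iff_ite]
    intro i j
    refine Fin.cases ?_ (fun i => ?_) i <;> refine Fin.cases ?_ (fun j => ?_) j
    · simp [hx]
    · simpa [(Fin.succ_ne_zero j).symm] using he.1 j
    · simpa [Fin.succ_ne_zero i, real_inner_comm] using he.1 i
    · simpa using he.2 i j
  refine ⟨OrthonormalBasis.mk hon ?_, ?_, ?_⟩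
  · exact (hon.linearIndependent.span_eq_top_of_card_eq_finrank' (by simp)).ge
  · simp
  · simp

/-- The differential of the metric coefficient of `A[φ]` along the directions of an orthonormal
frame diagonalizing the Hessian. -/
lemma Homog0.fderiv_metricCoeff {n : ℕ} {φ : Euc n → ℝ} (h0 : Homog0 φ) (hφ : SmoothFn φ)
    {x : Euc n} (hx : ‖x‖ = 1) (hpos : φ x ≠ 0) {e : Fin n → Euc n} (he : OrthoFrame x e)
    (hdiag : ∀ i j, i ≠ j → hessS φ x (e i) (e j) = 0) :
    DifferentiableAt ℝ (metricCoeff φ) x ∧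
      ∀ i, fderiv ℝ (metricCoeff φ) x (e i) =
        fderiv ℝ φ x (e i) - fderiv ℝ φ x (e i) / φ x * Aform φ x (e i) (e i) := by
  have hx0 : x ≠ 0 := by rintro rfl; simp at hx
  obtain ⟨b, hb0, hb⟩ := he.exists_orthonormalBasis hx
  have hnorm : ∀ y, y ≠ 0 → ‖gradS φ y‖ ^ 2 = ∑ k, fderiv ℝ φ y (b k) ^ 2 := by
    intro y hy
    rw [h0.gradS_eq hφ hy, ← b.sum_sq_norm_inner_right]
    refine Finset.sum_congr rfl fun k _ => ?_
    rw [real_inner_comm, gradient, InnerProductSpace.toDual_symm_apply, Real.norm_eq_abs, sq_abs]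
  have hev : metricCoeff φ =ᶠ[nhds x] fun y =>
      (φ y - (φ y)⁻¹) / 2 - (∑ k, fderiv ℝ φ y (b k) ^ 2) / (2 * φ y) := by
    filter_upwards [isOpen_ne.mem_nhds hx0] with y hy
    rw [metricCoeff, hnorm y hy]
  have hφd : DifferentiableAt ℝ φ x := (hφ.contDiffAt hx0).differentiableAt (by simp)
  have hGd : DifferentiableAt ℝ (fderiv ℝ φ) x :=
    (hφ.contDiffAt_fderiv hx0).differentiableAt (by simp)
  have hdiff : DifferentiableAt ℝ (metricCoeff φ) x := by
    refine DifferentiableAt.congr_of_eventuallyEq ?_ hev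
    have : 2 * φ x ≠ 0 := by positivity
    fun_prop (disch := assumption)
  refine ⟨hdiff, fun i => ?_⟩
  have hφl : HasDerivAt (fun t : ℝ => φ (x + t • e i)) (fderiv ℝ φ x (e i)) 0 :=
    hφd.hasFDerivAt.hasLineDerivAt (e i)
  have hql : HasDerivAt (fun t : ℝ => ∑ k, fderiv ℝ φ (x + t • e i) (b k) ^ 2)
      (2 * (fderiv ℝ φ x (e i) * hessS φ x (e i) (e i))) 0 := by
    have h1 : ∀ k, HasDerivAt (fun t : ℝ => fderiv ℝ φ (x + t • e i) (b k) ^ 2)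
        (2 * (fderiv ℝ φ x (b k) * fderiv ℝ (fderiv ℝ φ) x (e i) (b k))) 0 := by
      intro k
      have h2 : HasDerivAt (fun t : ℝ => fderiv ℝ φ (x + t • e i) (b k))
          (fderiv ℝ (fderiv ℝ φ) x (e i) (b k)) 0 := by
        have h3 := (hGd.hasFDerivAt.clm_apply (hasFDerivAt_const (b k) x)).hasLineDerivAt (e i)
        refine HasDerivAt.congr_deriv h3 ?_
        simp
      refine (h2.pow 2).congr_deriv ?_
      simp
      ring
    refine (HasDerivAt.fun_sum fun k _ => h1 k).congr_deriv ?_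
    rw [Fin.sum_univ_succ, hb0, h0.fderiv_self hφ hx0, Finset.sum_eq_single i]
    · rw [hb, h0.hessS_eq hφ hx0, tanProj_eq_self (he.1 i)]
      ring
    · intro j _ hj
      have := hdiag i j hj.symm
      rw [h0.hessS_eq hφ hx0, tanProj_eq_self (he.1 i)] at this
      rw [hb, this]
      ring
    · simp
  have hx' : φ (x + (0 : ℝ) • e i) ≠ 0 := by simpa using hpos
  have hl := ((hφl.sub (hφl.inv hx')).div_const 2).sub
    (hql.div (hφl.const_mul 2) (mul_ne_zero two_ne_zero hx'))
  have hm := (hdiff.hasFDerivAt.congr_of_eventuallyEq hev.symm).hasLineDerivAt (e i)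
  rw [HasDerivAt.unique hm hl, Aform, tanProj_eq_self (he.1 i), he.2 i i, hnorm x hx0]
  simp
  field_simp
  ring

/-- **Commutation identity for first covariant derivatives of `A[φ]`** (Lemma 3.4 (3.6) of
Luo–Wei): at a point `x ∈ 𝕊ⁿ` where the Hessian of `φ` is diagonal in the orthonormal tangent
frame `e`, one has `A_{αβi} - A_{iβα} = (φ_α/φ) A_{αα} δ_{iβ} - (φ_i/φ) A_{ii} δ_{αβ}`
(the last lower index is the direction of covariant differentiation). -/
theorem codazzi_defect_of_A (n : ℕ) (φ : Euc n → ℝ)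
    (hφ0 : Homog0 φ) (hφs : SmoothFn φ) (hφpos : ∀ y ∈ uSphere n, 0 < φ y)
    (x : Euc n) (hx : x ∈ uSphere n) (e : Fin n → Euc n) (he : OrthoFrame x e)
    (hdiag : ∀ i j, i ≠ j → hessS φ x (e i) (e j) = 0) :
    ∀ i α β : Fin n,
      covA1 φ x (e i) (e α) (e β) - covA1 φ x (e α) (e i) (e β) =
        covD φ x (e α) / φ x * Aform φ x (e α) (e α) * (if i = β then 1 else 0) -
          covD φ x (e i) / φ x * Aform φ x (e i) (e i) * (if α = β then 1 else 0) := by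
  intro i α β
  have hx1 : ‖x‖ = 1 := by simpa [uSphere] using hx
  have hx0 : x ≠ 0 := by rintro rfl; simp at hx1
  obtain ⟨hc, hce⟩ := hφ0.fderiv_metricCoeff hφs hx1 (hφpos x hx).ne' he hdiag
  rw [hφ0.covA1_eq hφs hx1 hc (he.1 i) (he.1 α) (he.1 β),
    hφ0.covA1_eq hφs hx1 hc (he.1 α) (he.1 i) (he.1 β),
    hφs.fderiv_fderiv_fderiv_comm hx0 (e i) (e α), real_inner_comm (e i) (e α),
    hce, hce, hφ0.covD_eq hφs hx0, hφ0.covD_eq hφs hx0, he.2 i β, he.2 α β]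
  ring
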